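/- arXiv:1603.05872 — 3 statements merged into one kernel-verified Lean document; each statement's English description precedes it below -/
import Mathlib

section
/- For every natural number n ≥ 1 and every real x, |φ_n(x) − max(x, 0)| ≤ √(2/(nπ)); consequently, for each fixed x ∈ ℝ, φ_n(x) → max(x, 0) as n → ∞. -/
open Real MeasureTheory Filter

/-- The centered Gaussian density with variance `1/n`. -/
noncomputable def gaussApprox (n : ℕ) (x : ℝ) : ℝ :=
  Real.sqrt (n / (2 * Real.pi)) * Real.exp (-(n * x ^ 2) / 2)

/-- The smoothed positive part `φ_n x = ∫_ℝ max (x − y) 0 · g_n y dy`. -/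
noncomputable def phiApprox (n : ℕ) (x : ℝ) : ℝ :=
  ∫ y : ℝ, max (x - y) 0 * gaussApprox n y

lemma gaussApprox_eq (n : ℕ) (y : ℝ) :
    gaussApprox n y = √(n / (2 * π)) * rexp (-(n / 2 : ℝ) * y ^ 2) := by
  rw [gaussApprox]
  ring_nf

lemma gaussApprox_nonneg (n : ℕ) (y : ℝ) : 0 ≤ gaussApprox n y := by
  unfold gaussApprox
  positivity

lemma gaussApprox_abs (n : ℕ) (y : ℝ) : gaussApprox n |y| = gaussApprox n y := by
  simp only [gaussApprox, sq_abs]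

lemma integrable_gaussApprox {n : ℕ} (hn : 1 ≤ n) : Integrable (gaussApprox n) := by
  have hb : (0 : ℝ) < n / 2 := by positivity
  simpa only [funext (gaussApprox_eq n)] using (integrable_exp_neg_mul_sq hb).const_mul _

lemma integrable_mul_gaussApprox {n : ℕ} (hn : 1 ≤ n) :
    Integrable fun y ↦ y * gaussApprox n y := by
  have hb : (0 : ℝ) < n / 2 := by positivity
  simpa only [gaussApprox_eq, mul_left_comm] using
    (integrable_mul_exp_neg_mul_sq hb).const_mul √(n / (2 * π))

lemma integrable_abs_mul_gaussApprox {n : ℕ} (hn : 1 ≤ n) :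
    Integrable fun y ↦ |y| * gaussApprox n y := by
  simpa only [norm_mul, norm_eq_abs, abs_of_nonneg (gaussApprox_nonneg n _)] using
    (integrable_mul_gaussApprox hn).norm

lemma integral_gaussApprox {n : ℕ} (hn : 1 ≤ n) : ∫ y, gaussApprox n y = 1 := by
  have hn' : (0 : ℝ) < n := by positivity
  simp only [gaussApprox_eq]
  rw [integral_const_mul, integral_gaussian, ← sqrt_mul (by positivity), sqrt_eq_one]
  field_simp

lemma integral_abs_mul_gaussApprox {n : ℕ} (hn : 1 ≤ n) :
    ∫ y, |y| * gaussApprox n y = √(2 / (n * π)) := by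
  have hn' : (0 : ℝ) < n := by positivity
  have half : ∫ y in Set.Ioi (0 : ℝ), y * rexp (-(n / 2 : ℝ) * y ^ 2) = (n : ℝ)⁻¹ := by
    have h := integral_rpow_mul_exp_neg_mul_rpow (p := 2) (q := 1) (b := n / 2)
      (by norm_num) (by norm_num) (by positivity)
    norm_num [rpow_neg_one] at h
    simp only [neg_mul]
    rw [h]
  have habs := integral_comp_abs (f := fun y ↦ y * gaussApprox n y)
  simp only [gaussApprox_abs] at habs
  rw [habs]
  simp only [gaussApprox_eq, mul_left_comm _ √(n / (2 * π))]
  rw [integral_const_mul, half, eq_comm, sqrt_eq_iff_mul_self_eq (by positivity) (by positivity)]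
  have hs : √(n / (2 * π)) * √(n / (2 * π)) = n / (2 * π) := mul_self_sqrt (by positivity)
  symm
  calc 2 * (√(n / (2 * π)) * (n : ℝ)⁻¹) * (2 * (√(n / (2 * π)) * (n : ℝ)⁻¹))
      = 4 * (√(n / (2 * π)) * √(n / (2 * π))) * ((n : ℝ)⁻¹ * (n : ℝ)⁻¹) := by ring
    _ = 2 / (n * π) := by rw [hs]; field_simp; norm_num

lemma abs_posPart_sub_sub_posPart_le (x y : ℝ) : |max (x - y) 0 - max x 0| ≤ |y| := by
  simpa using abs_max_sub_max_le_abs (x - y) x 0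

lemma integrable_posPart_sub_mul_gaussApprox {n : ℕ} (hn : 1 ≤ n) (x : ℝ) :
    Integrable fun y ↦ max (x - y) 0 * gaussApprox n y := by
  refine (((integrable_gaussApprox hn).const_mul |x|).add
    (integrable_abs_mul_gaussApprox hn)).mono' ?_ (ae_of_all _ fun y ↦ ?_)
  · unfold gaussApprox
    exact Continuous.aestronglyMeasurable (by fun_prop)
  · rw [norm_mul, norm_eq_abs, norm_eq_abs, abs_of_nonneg (gaussApprox_nonneg n y), Pi.add_apply,
      ← add_mul]
    refine mul_le_mul_of_nonneg_right ?_ (gaussApprox_nonneg n y)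
    rw [abs_of_nonneg (le_max_right _ _)]
    exact max_le ((le_abs_self _).trans (abs_sub x y)) (by positivity)

lemma abs_phiApprox_sub_posPart_le {n : ℕ} (hn : 1 ≤ n) (x : ℝ) :
    |phiApprox n x - max x 0| ≤ √(2 / (n * π)) := by
  have hsub : phiApprox n x - max x 0 =
      ∫ y, (max (x - y) 0 - max x 0) * gaussApprox n y := by
    simp only [sub_mul]
    rw [integral_sub (integrable_posPart_sub_mul_gaussApprox hn x)
      ((integrable_gaussApprox hn).const_mul _), integral_const_mul, integral_gaussApprox hn,
      mul_one, phiApprox]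
  rw [hsub, ← integral_abs_mul_gaussApprox hn, ← norm_eq_abs]
  refine norm_integral_le_of_norm_le (integrable_abs_mul_gaussApprox hn) (ae_of_all _ fun y ↦ ?_)
  rw [norm_mul, norm_eq_abs, norm_eq_abs, abs_of_nonneg (gaussApprox_nonneg n y)]
  exact mul_le_mul_of_nonneg_right (abs_posPart_sub_sub_posPart_le x y) (gaussApprox_nonneg n y)

/-- For every `n ≥ 1` and every real `x`, `|φ_n(x) − max(x,0)| ≤ √(2/(nπ))`;
consequently `φ_n(x) → max(x,0)` as `n → ∞`. -/
theorem phiApprox_tendsto_posPart (x : ℝ) :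
    (∀ n : ℕ, 1 ≤ n → |phiApprox n x - max x 0| ≤ Real.sqrt (2 / (n * Real.pi))) ∧
    Tendsto (fun n : ℕ => phiApprox n x) atTop (nhds (max x 0)) := by
  refine ⟨fun n hn ↦ abs_phiApprox_sub_posPart_le hn x, ?_⟩
  have hlim : Tendsto (fun n : ℕ ↦ √(2 / (n * π))) atTop (nhds 0) := by
    have h : Tendsto (fun n : ℕ ↦ 2 / (n * π)) atTop (nhds 0) :=
      (tendsto_natCast_atTop_atTop.atTop_mul_const pi_pos).const_div_atTop 2
    simpa using h.sqrt
  refine tendsto_iff_norm_sub_tendsto_zero.mpr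
    (squeeze_zero' (Eventually.of_forall fun _ ↦ norm_nonneg _) ?_ hlim)
  filter_upwards [eventually_ge_atTop 1] with n hn
  exact abs_phiApprox_sub_posPart_le hn x
end

section
/- For every real x, e^{−1} e^{−|x|} ≤ J(x) ≤ e · e^{−|x|}, where J(x) = ∫_ℝ e^{−|y|} ρ_0(x − y) dy. -/
open Real MeasureTheory

/-- The mollifier `ρ₀(x) = C̃ exp(−1/(1−x²)) 1_{|x|<1}`. -/
noncomputable def mollifier (Ctil : ℝ) (x : ℝ) : ℝ :=
  if |x| < 1 then Ctil * Real.exp (-1 / (1 - x ^ 2)) else 0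

/-- The smoothed exponential weight `J(x) = ∫_ℝ e^{−|y|} ρ₀(x − y) dy`. -/
noncomputable def Jweight (Ctil : ℝ) (x : ℝ) : ℝ :=
  ∫ y : ℝ, Real.exp (-|y|) * mollifier Ctil (x - y)

theorem mollifier_nonneg {Ctil : ℝ} (hC : 0 ≤ Ctil) (x : ℝ) : 0 ≤ mollifier Ctil x := by
  unfold mollifier
  split_ifs <;> positivity

theorem mollifier_eq_zero {Ctil x : ℝ} (hx : 1 ≤ |x|) : mollifier Ctil x = 0 :=
  if_neg hx.not_gt

theorem exp_mul_mollifier_le {Ctil : ℝ} (hC : 0 ≤ Ctil) (x y : ℝ) :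
    Real.exp (-|y|) * mollifier Ctil (x - y) ≤
      Real.exp 1 * Real.exp (-|x|) * mollifier Ctil (x - y) := by
  rcases lt_or_ge |x - y| 1 with h | h
  · refine mul_le_mul_of_nonneg_right ?_ (mollifier_nonneg hC _)
    rw [← Real.exp_add, Real.exp_le_exp]
    linarith [abs_sub_abs_le_abs_sub x y]
  · simp [mollifier_eq_zero h]

theorem le_exp_mul_mollifier {Ctil : ℝ} (hC : 0 ≤ Ctil) (x y : ℝ) :
    Real.exp (-1) * Real.exp (-|x|) * mollifier Ctil (x - y) ≤
      Real.exp (-|y|) * mollifier Ctil (x - y) := by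
  rcases lt_or_ge |x - y| 1 with h | h
  · refine mul_le_mul_of_nonneg_right ?_ (mollifier_nonneg hC _)
    rw [← Real.exp_add, Real.exp_le_exp]
    linarith [abs_sub_abs_le_abs_sub y x, abs_sub_comm x y]
  · simp [mollifier_eq_zero h]

/-- For every real `x`, `e⁻¹ e^{−|x|} ≤ J(x) ≤ e · e^{−|x|}`, where `C̃ > 0` is the
normalizing constant making `∫ ρ₀ = 1`. -/
theorem Jweight_two_sided_bound (Ctil : ℝ) (hC : 0 < Ctil)
    (hnorm : (∫ x : ℝ, mollifier Ctil x) = 1) (x : ℝ) :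
    Real.exp (-1) * Real.exp (-|x|) ≤ Jweight Ctil x ∧
    Jweight Ctil x ≤ Real.exp 1 * Real.exp (-|x|) := by
  have hint : Integrable (fun y => mollifier Ctil (x - y)) :=
    (Integrable.of_integral_ne_zero (by rw [hnorm]; exact one_ne_zero)).comp_sub_left x
  have hone (c : ℝ) : ∫ y, c * mollifier Ctil (x - y) = c := by
    rw [integral_const_mul, integral_sub_left_eq_self (mollifier Ctil) volume x, hnorm, mul_one]
  have hJ : Integrable (fun y => Real.exp (-|y|) * mollifier Ctil (x - y)) := by
    refine hint.bdd_mul (c := 1) (by fun_prop) (.of_forall fun y => ?_)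
    simp
  constructor
  · rw [← hone (Real.exp (-1) * Real.exp (-|x|))]
    exact integral_mono (hint.const_mul _) hJ (le_exp_mul_mollifier hC.le x)
  · rw [← hone (Real.exp 1 * Real.exp (-|x|))]
    exact integral_mono hJ (hint.const_mul _) (exp_mul_mollifier_le hC.le x)
end

section
/- Let γ : [0,1]² → [0,∞) be measurable with γ(a,b) ≤ K for all (a,b) ∈ [0,1]². Then for all x₁, x₂ ∈ [0,1] with x₁ ≤ x₂, ∫_0^1 ∫_0^1 ( 1_{{a ≤ x₁ ≤ b}} √(γ(a,b)) − 1_{{a ≤ x₂ ≤ b}} √(γ(a,b)) )² db da ≤ K (x₂ − x₁). -/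
open Real MeasureTheory

theorem integrable_indicator_Icc_const (l r c : ℝ) (t : Set ℝ) :
    Integrable ((Set.Icc l r).indicator fun _ => c) (volume.restrict t) :=
  ((integrable_indicator_iff measurableSet_Icc).2
    (integrableOn_const measure_Icc_lt_top.ne)).mono_measure Measure.restrict_le_self

theorem setIntegral_indicator_Icc_const_le {l r c : ℝ} (hlr : l ≤ r) (hc : 0 ≤ c) (t : Set ℝ) :
    ∫ x in t, (Set.Icc l r).indicator (fun _ => c) x ≤ c * (r - l) := by
  calc ∫ x in t, (Set.Icc l r).indicator (fun _ => c) x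
      ≤ ∫ x, (Set.Icc l r).indicator (fun _ => c) x := by
        refine setIntegral_le_integral ?_ ?_
        · simpa using integrable_indicator_Icc_const l r c Set.univ
        · exact .of_forall fun x => Set.indicator_nonneg (fun _ _ => hc) x
    _ = c * (r - l) := by
        rw [integral_indicator_const _ measurableSet_Icc, Real.volume_real_Icc_of_le hlr,
          smul_eq_mul, mul_comm]

/-- A nonnegative function on `t` bounded by `c` on `[l, r]` and vanishing elsewhere has
integral at most `c * (r - l)`; no measurability is needed. -/
theorem setIntegral_le_of_le_indicator_Icc {f : ℝ → ℝ} {l r c : ℝ} {t : Set ℝ}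
    (ht : MeasurableSet t) (hlr : l ≤ r) (hc : 0 ≤ c) (hf : ∀ x ∈ t, 0 ≤ f x)
    (hfc : ∀ x ∈ t, f x ≤ (Set.Icc l r).indicator (fun _ => c) x) :
    ∫ x in t, f x ≤ c * (r - l) :=
  (integral_mono_of_nonneg (ae_restrict_of_forall_mem ht hf)
    (integrable_indicator_Icc_const l r c t) (ae_restrict_of_forall_mem ht hfc)).trans
    (setIntegral_indicator_Icc_const_le hlr hc t)

/-- Let `γ : [0,1]² → [0,∞)` be measurable with `γ ≤ K`. Then for `x₁ ≤ x₂` in `[0,1]`,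
`∫₀¹ ∫₀¹ (1_{a ≤ x₁ ≤ b} √γ(a,b) − 1_{a ≤ x₂ ≤ b} √γ(a,b))² db da ≤ K (x₂ − x₁)`. -/
theorem fv_coefficient_lipschitz (γ : ℝ → ℝ → ℝ) (K : ℝ)
    (hmeas : Measurable fun p : ℝ × ℝ => γ p.1 p.2)
    (hnonneg : ∀ a ∈ Set.Icc (0:ℝ) 1, ∀ b ∈ Set.Icc (0:ℝ) 1, 0 ≤ γ a b)
    (hbdd : ∀ a ∈ Set.Icc (0:ℝ) 1, ∀ b ∈ Set.Icc (0:ℝ) 1, γ a b ≤ K)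
    (x₁ x₂ : ℝ) (hx₁ : x₁ ∈ Set.Icc (0:ℝ) 1) (hx₂ : x₂ ∈ Set.Icc (0:ℝ) 1)
    (hle : x₁ ≤ x₂) :
    (∫ a in (0:ℝ)..1, ∫ b in (0:ℝ)..1,
        ((if a ≤ x₁ ∧ x₁ ≤ b then Real.sqrt (γ a b) else 0)
          - (if a ≤ x₂ ∧ x₂ ≤ b then Real.sqrt (γ a b) else 0)) ^ 2)
      ≤ K * (x₂ - x₁) := by
  obtain ⟨h₁, h₁'⟩ := hx₁
  obtain ⟨h₂, h₂'⟩ := hx₂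
  have hK : 0 ≤ K := (hnonneg 0 (by simp) 0 (by simp)).trans (hbdd 0 (by simp) 0 (by simp))
  have hd : 0 ≤ x₂ - x₁ := sub_nonneg.2 hle
  have hd' : 0 ≤ 1 - x₂ := sub_nonneg.2 h₂'
  have hsq : ∀ a ∈ Set.Ioc (0:ℝ) 1, ∀ b ∈ Set.Ioc (0:ℝ) 1, √(γ a b) ^ 2 ≤ K := by
    intro a ha b hb
    have ha' := Set.Ioc_subset_Icc_self ha
    have hb' := Set.Ioc_subset_Icc_self hb
    rw [Real.sq_sqrt (hnonneg a ha' b hb')]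
    exact hbdd a ha' b hb'
  simp only [intervalIntegral.integral_of_le zero_le_one]
  have hinner : ∀ a ∈ Set.Ioc (0:ℝ) 1, (∫ b in Set.Ioc (0:ℝ) 1,
        ((if a ≤ x₁ ∧ x₁ ≤ b then √(γ a b) else 0)
          - (if a ≤ x₂ ∧ x₂ ≤ b then √(γ a b) else 0)) ^ 2)
      ≤ (Set.Icc 0 x₁).indicator (fun _ => K * (x₂ - x₁)) a
        + (Set.Icc x₁ x₂).indicator (fun _ => K * (1 - x₂)) a := by
    intro a ha
    rcases le_or_gt a x₁ with ha₁ | ha₁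
    · have hr : 0 ≤ (Set.Icc x₁ x₂).indicator (fun _ => K * (1 - x₂)) a :=
        Set.indicator_nonneg (fun _ _ => mul_nonneg hK hd') a
      rw [Set.indicator_of_mem (show a ∈ Set.Icc 0 x₁ from ⟨ha.1.le, ha₁⟩)]
      refine le_add_of_le_of_nonneg ?_ hr
      refine setIntegral_le_of_le_indicator_Icc measurableSet_Ioc hle hK
        (fun _ _ => sq_nonneg _) fun b hb => ?_
      have := hsq a ha b hb
      simp only [Set.indicator_apply, Set.mem_Icc]
      split_ifs <;> first | (simp; done) | (simpa using this) | (simpa using hK) | grind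
    · rw [Set.indicator_of_notMem (show a ∉ Set.Icc 0 x₁ from fun h => ha₁.not_ge h.2), zero_add]
      rcases le_or_gt a x₂ with ha₂ | ha₂
      · rw [Set.indicator_of_mem (show a ∈ Set.Icc x₁ x₂ from ⟨ha₁.le, ha₂⟩)]
        refine setIntegral_le_of_le_indicator_Icc measurableSet_Ioc h₂' hK
          (fun _ _ => sq_nonneg _) fun b hb => ?_
        have := hsq a ha b hb
        have := hb.2
        simp only [Set.indicator_apply, Set.mem_Icc]
        split_ifs <;> first | (simp; done) | (simpa using this) | (simpa using hK) | grind
      · simp [ha₁.not_ge, ha₂.not_ge]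
  calc _ ≤ ∫ a in Set.Ioc (0:ℝ) 1, ((Set.Icc 0 x₁).indicator (fun _ => K * (x₂ - x₁)) a
        + (Set.Icc x₁ x₂).indicator (fun _ => K * (1 - x₂)) a) :=
        integral_mono_of_nonneg (.of_forall fun a => integral_nonneg fun b => sq_nonneg _)
          ((integrable_indicator_Icc_const _ _ _ _).add (integrable_indicator_Icc_const _ _ _ _))
          (ae_restrict_of_forall_mem measurableSet_Ioc hinner)
    _ ≤ K * (x₂ - x₁) * (x₁ - 0) + K * (1 - x₂) * (x₂ - x₁) := by
        rw [integral_add (integrable_indicator_Icc_const _ _ _ _)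
          (integrable_indicator_Icc_const _ _ _ _)]
        exact add_le_add
          (setIntegral_indicator_Icc_const_le h₁ (mul_nonneg hK hd) _)
          (setIntegral_indicator_Icc_const_le hle (mul_nonneg hK hd') _)
    _ ≤ K * (x₂ - x₁) := by
        nlinarith [mul_nonneg (mul_nonneg hK hd) hd]
end
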